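/- arXiv:1502.07470 — 6 statements merged into one kernel-verified Lean document; each statement's English description precedes it below -/
import Mathlib

section
/- If there exists a nontrivial complete Boolean algebra B (with ⊥ ≠ ⊤) which is atomless (every b ≠ ⊥ has some c with ⊥ ≠ c ≤ b and c ≠ b), satisfies the countable chain condition, and is (ω,ω)-distributive, then there exists a Souslin tree. -/
/-- A Souslin tree: an uncountable partial order in which the set of predecessors of
every element is well-ordered by `<`, and every chain and every antichain is countable. -/
def IsSouslinTree (T : Type) [PartialOrder T] : Prop :=
  Uncountable T ∧
  (∀ t : T, IsWellOrder {s : T // s < t} (fun a b => a.1 < b.1)) ∧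
  (∀ C : Set T, (∀ a ∈ C, ∀ b ∈ C, a ≠ b → a < b ∨ b < a) → C.Countable) ∧
  (∀ A : Set T, (∀ a ∈ A, ∀ b ∈ A, a ≠ b → ¬ a < b ∧ ¬ b < a) → A.Countable)

namespace SouslinOfDistributive

section

variable {B : Type} [CompleteBooleanAlgebra B]

/-- The element `b` or its complement, according to a sign. -/
def literal (b : B) (i : Bool) : B := if i then b else bᶜ

lemma disjoint_literal (b : B) {i j : Bool} (h : i ≠ j) : Disjoint (literal b i) (literal b j) := by
  cases i <;> cases j <;> simp_all [literal, disjoint_compl_left, disjoint_compl_right]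

/-- The cell of height `α` cut out by the sequence `r` along the branch `x`. -/
noncomputable def cell (r : Ordinal.{0} → B) (x : Ordinal.{0} → Bool) (α : Ordinal.{0}) : B :=
  ⨅ β : Set.Iio α, literal (r β) (x β)

lemma cell_le_literal (r : Ordinal.{0} → B) (x : Ordinal.{0} → Bool) {β α : Ordinal.{0}}
    (h : β < α) : cell r x α ≤ literal (r β) (x β) :=
  iInf_le (fun β : Set.Iio α => literal (r β) (x β)) ⟨β, h⟩

lemma cell_antitone (r : Ordinal.{0} → B) (x : Ordinal.{0} → Bool) : Antitone (cell r x) :=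
  fun _ _ h => le_iInf fun γ => cell_le_literal r x (lt_of_lt_of_le γ.2 h)

lemma cell_congr (r : Ordinal.{0} → B) {x y : Ordinal.{0} → Bool} {α : Ordinal.{0}}
    (h : ∀ β < α, x β = y β) : cell r x α = cell r y α :=
  iInf_congr fun β => by rw [h β β.2]

lemma disjoint_cell (r : Ordinal.{0} → B) {x y : Ordinal.{0} → Bool} {α β γ : Ordinal.{0}}
    (hα : γ < α) (hβ : γ < β) (h : x γ ≠ y γ) : Disjoint (cell r x α) (cell r y β) :=
  (disjoint_literal (r γ) h).mono (cell_le_literal r x hα) (cell_le_literal r y hβ)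

lemma cell_eq_or_disjoint (r : Ordinal.{0} → B) (x y : Ordinal.{0} → Bool) {α β : Ordinal.{0}}
    (h : α ≤ β) : cell r x α = cell r y α ∨ Disjoint (cell r x α) (cell r y β) := by
  by_cases hxy : ∀ γ < α, x γ = y γ
  · exact .inl (cell_congr r hxy)
  · push Not at hxy
    obtain ⟨γ, hγ, hne⟩ := hxy
    exact .inr (disjoint_cell r hγ (hγ.trans_le h) hne)

lemma le_or_le_or_disjoint_cell (r : Ordinal.{0} → B) (x y : Ordinal.{0} → Bool)
    (α β : Ordinal.{0}) :
    cell r x α ≤ cell r y β ∨ cell r y β ≤ cell r x α ∨ Disjoint (cell r x α) (cell r y β) := by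
  rcases le_total α β with h | h
  · rcases cell_eq_or_disjoint r x y h with h' | h'
    · exact .inr (.inl (h' ▸ cell_antitone r y h))
    · exact .inr (.inr h')
  · rcases cell_eq_or_disjoint r y x h with h' | h'
    · exact .inl (h' ▸ cell_antitone r x h)
    · exact .inr (.inr h'.symm)

/-- The sequence `r` splits each of its nonzero cells. -/
def Splits (r : Ordinal.{0} → B) : Prop :=
  ∀ x β i, cell r x β ≠ ⊥ → cell r x β ⊓ literal (r β) i ≠ ⊥

/-- The sequence whose `α`-th term is the join of the pieces which `s` selects from the cells of
height `α`. -/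
noncomputable def splitSeq (s : B → B) (α : Ordinal.{0}) : B :=
  ⨆ y : Ordinal.{0} → Bool, s (⨅ β : Set.Iio α, literal (splitSeq s β) (y β))
termination_by α
decreasing_by exact β.2

lemma cell_inf_splitSeq {s : B → B} (hs : ∀ b, s b ≤ b) (x : Ordinal.{0} → Bool)
    (α : Ordinal.{0}) :
    cell (splitSeq s) x α ⊓ splitSeq s α = s (cell (splitSeq s) x α) := by
  have h : splitSeq s α = ⨆ y, s (cell (splitSeq s) y α) := by
    rw [splitSeq]; rfl
  rw [h, inf_iSup_eq]
  apply le_antisymm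
  · refine iSup_le fun y => ?_
    rcases cell_eq_or_disjoint (splitSeq s) x y le_rfl with h' | h'
    · rw [h']; exact inf_le_right
    · rw [(h'.mono_right (hs _)).eq_bot]; exact bot_le
  · exact le_iSup_of_le x (le_inf (hs _) le_rfl)

lemma exists_splits (hB : ∀ b : B, b ≠ ⊥ → ∃ c : B, c ≠ ⊥ ∧ c ≤ b ∧ c ≠ b) :
    ∃ r : Ordinal.{0} → B, Splits r := by
  have hB' : ∀ b : B, ∃ c : B, c ≤ b ∧ (b ≠ ⊥ → c ≠ ⊥ ∧ c ≠ b) := fun b => by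
    by_cases hb : b = ⊥
    · exact ⟨⊥, bot_le, fun h => (h hb).elim⟩
    · obtain ⟨c, h0, hle, hne⟩ := hB b hb
      exact ⟨c, hle, fun _ => ⟨h0, hne⟩⟩
  choose s hs hs' using hB'
  refine ⟨splitSeq s, fun x β i h => ?_⟩
  have key := cell_inf_splitSeq hs x β
  cases i with
  | true => simpa [literal, key] using (hs' _ h).1
  | false =>
    intro h'
    have hle : cell (splitSeq s) x β ≤ splitSeq s β := by
      simpa [literal, ← sdiff_eq, sdiff_eq_bot_iff] using h'
    exact (hs' _ h).2 (by rw [← key, inf_eq_left.2 hle])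

lemma Splits.cell_lt {r : Ordinal.{0} → B} (hr : Splits r) (x : Ordinal.{0} → Bool)
    {β α : Ordinal.{0}} (h : β < α) (hne : cell r x β ≠ ⊥) : cell r x α < cell r x β := by
  refine lt_of_le_of_ne (cell_antitone r x h.le) fun heq => hr x β (!x β) hne ?_
  have := (disjoint_literal (r β) (i := x β) (j := !x β) (by simp)).mono_left
    (cell_le_literal r x h)
  rw [heq] at this
  exact this.eq_bot

/-- The nonzero cells. -/
def cells (r : Ordinal.{0} → B) : Set B := {b | b ≠ ⊥ ∧ ∃ x α, b = cell r x α}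

lemma le_or_le_or_disjoint_of_mem_cells {r : Ordinal.{0} → B} {a b : B} (ha : a ∈ cells r)
    (hb : b ∈ cells r) : a ≤ b ∨ b ≤ a ∨ Disjoint a b := by
  obtain ⟨-, x, α, rfl⟩ := ha
  obtain ⟨-, y, β, rfl⟩ := hb
  exact le_or_le_or_disjoint_cell r x y α β

/-- A nonzero cell lying strictly above `cell r x α` is an earlier cell of the same branch. -/
lemma exists_lt_eq_cell {r : Ordinal.{0} → B} {x : Ordinal.{0} → Bool} {α : Ordinal.{0}} {b : B}
    (h0 : cell r x α ≠ ⊥) (hb : b ∈ cells r) (hlt : cell r x α < b) :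
    ∃ β < α, b = cell r x β := by
  obtain ⟨-, y, β, rfl⟩ := hb
  have hnd : ¬ Disjoint (cell r x α) (cell r y β) := fun h => h0 (h.eq_bot_of_le hlt.le)
  rcases le_or_gt α β with h | h
  · have := (cell_eq_or_disjoint r x y h).resolve_right hnd
    exact absurd (this ▸ cell_antitone r y h) hlt.not_ge
  · exact ⟨β, h, (cell_eq_or_disjoint r y x h.le).resolve_right fun h => hnd h.symm⟩

lemma exists_cell_ne_bot (r : Ordinal.{0} → B) (hB : (⊥ : B) ≠ ⊤)
    (hd : ∀ a : ℕ → ℕ → B, ⨅ n, ⨆ m, a n m = ⨆ f : ℕ → ℕ, ⨅ n, a n (f n))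
    (α : Ordinal.{0}) [Countable (Set.Iio α)] : ∃ x, cell r x α ≠ ⊥ := by
  rcases isEmpty_or_nonempty (Set.Iio α) with hα | hα
  · exact ⟨fun _ => true, by rw [cell, iInf_of_empty]; exact hB.symm⟩
  obtain ⟨e, he⟩ := exists_surjective_nat (Set.Iio α)
  have htop : ⨆ f : ℕ → ℕ, ⨅ n, literal (r (e n)) (decide (f n = 0)) = ⊤ := by
    rw [← hd fun n m => literal (r (e n)) (decide (m = 0)), iInf_eq_top]
    refine fun n => top_le_iff.1 ?_
    rw [← sup_compl_eq_top (x := r (e n))]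
    exact sup_le (le_iSup_of_le 0 (by simp [literal])) (le_iSup_of_le 1 (by simp [literal]))
  obtain ⟨f, hf⟩ : ∃ f : ℕ → ℕ, ⨅ n, literal (r (e n)) (decide (f n = 0)) ≠ ⊥ := by
    by_contra! h
    exact hB (by rw [← htop, iSup_eq_bot.2 h])
  classical
  set c := ⨅ n, literal (r (e n)) (decide (f n = 0)) with hc
  have hcn : ∀ n, c ≤ literal (r (e n)) (decide (f n = 0)) := fun n => iInf_le _ n
  refine ⟨fun β => decide (c ≤ r β), ne_bot_of_le_ne_bot hf (le_iInf fun β => ?_)⟩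
  obtain ⟨n, rfl⟩ := he β
  have := hcn n
  by_cases h : c ≤ r (e n)
  · simp [literal, h]
  · by_cases h0 : f n = 0 <;> simp_all [literal]

lemma countable_of_chain {r : Ordinal.{0} → B} (hr : Splits r)
    (hccc : ∀ A : Set B, (∀ a ∈ A, a ≠ ⊥) → A.Pairwise (fun a b => a ⊓ b = ⊥) → A.Countable)
    {C : Set B} (hC : C ⊆ cells r) (hchain : ∀ a ∈ C, ∀ b ∈ C, a ≠ b → a < b ∨ b < a) :
    C.Countable := by
  have hex : ∀ t ∈ C, ∃ d : B, d ≠ ⊥ ∧ d ≤ t ∧ ∀ u ∈ C, u < t → Disjoint d u := by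
    intro t ht
    obtain ⟨h0, x, β, rfl⟩ := hC ht
    by_contra! hcon
    have hbit : ∀ i, ∃ u ∈ C, ∃ y γ, u = cell r y γ ∧ β < γ ∧ y β = i := by
      intro i
      obtain ⟨u, huC, hut, hdis⟩ := hcon _ (hr x β i h0) inf_le_left
      obtain ⟨hu0, y, γ, rfl⟩ := hC huC
      obtain ⟨δ, hδ, heq⟩ := exists_lt_eq_cell hu0 (hC ht) hut
      have hβγ : β < γ := by
        by_contra! hle
        rcases cell_eq_or_disjoint r y x hle with h | h
        · exact absurd (h ▸ cell_antitone r x hle) hut.not_ge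
        · exact hu0 (h.eq_bot_of_le hut.le)
      refine ⟨_, huC, y, γ, rfl, hβγ, ?_⟩
      by_contra hne
      exact hdis (((disjoint_literal (r β) (Ne.symm hne)).mono_left inf_le_right).mono_right
        (cell_le_literal r y hβγ))
    obtain ⟨u, huC, y, γ, rfl, hγ, hy⟩ := hbit true
    obtain ⟨v, hvC, z, δ, rfl, hδ, hz⟩ := hbit false
    have hdis : Disjoint (cell r y γ) (cell r z δ) := disjoint_cell r hγ hδ (by simp [hy, hz])
    have hu0 := (hC huC).1
    have hv0 := (hC hvC).1
    rcases hchain _ huC _ hvC (hdis.ne hu0) with h | h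
    · exact hu0 (hdis.eq_bot_of_le h.le)
    · exact hv0 (hdis.symm.eq_bot_of_le h.le)
  choose! d hd0 hdt hdu using hex
  have hdis : ∀ t ∈ C, ∀ u ∈ C, t ≠ u → Disjoint (d t) (d u) := by
    intro t ht u hu hne
    rcases hchain t ht u hu hne with h | h
    · exact ((hdu u hu t ht h).mono_right (hdt t ht)).symm
    · exact (hdu t ht u hu h).mono_right (hdt u hu)
  have hinj : Set.InjOn d C := fun t ht u hu heq => by
    by_contra hne
    exact (hdis t ht u hu hne).ne (hd0 t ht) heq
  refine Set.countable_of_injective_of_countable_image hinj (hccc _ ?_ ?_)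
  · rintro _ ⟨t, ht, rfl⟩
    exact hd0 t ht
  · rintro _ ⟨t, ht, rfl⟩ _ ⟨u, hu, rfl⟩ hne
    exact (hdis t ht u hu fun h => hne (h ▸ rfl)).eq_bot

lemma uncountable_cells {r : Ordinal.{0} → B} (hr : Splits r) (hB : (⊥ : B) ≠ ⊤)
    (hd : ∀ a : ℕ → ℕ → B, ⨅ n, ⨆ m, a n m = ⨆ f : ℕ → ℕ, ⨅ n, a n (f n)) :
    Uncountable (cells r) := by
  have hex : ∀ α : Set.Iio (Ordinal.omega.{0} 1), ∃ x, cell r x α ≠ ⊥ := by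
    rintro ⟨α, hα⟩
    have : Countable (Set.Iio α) := by
      rw [← Cardinal.mk_le_aleph0_iff, Cardinal.mk_Iio_ordinal, Cardinal.lift_le_aleph0,
        ← Cardinal.lt_aleph_one_iff, ← Cardinal.lt_ord, Cardinal.ord_aleph]
      exact hα
    exact exists_cell_ne_bot r hB hd α
  choose x hx using hex
  have hun : Uncountable (Set.Iio (Ordinal.omega.{0} 1)) := by
    rw [← Cardinal.aleph0_lt_mk_iff, Cardinal.mk_Iio_ordinal, ← Cardinal.ord_aleph, Cardinal.card_ord]
    simp
  have hlt : ∀ α β : Set.Iio (Ordinal.omega.{0} 1), α < β → cell r (x α) α ≠ cell r (x β) β := by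
    intro α β h heq
    have hα : cell r (x α) α = cell r (x β) α :=
      (cell_eq_or_disjoint r (x α) (x β) (le_of_lt h)).resolve_right
        fun hdis => hdis.ne (hx α) heq
    exact (hr.cell_lt (x β) h (hα ▸ hx α)).ne (heq ▸ hα)
  have hinj : Function.Injective
      fun α => (⟨cell r (x α) α, hx α, x α, α, rfl⟩ : cells r) := by
    intro α β heq
    have heq' := congrArg Subtype.val heq
    rcases lt_trichotomy α β with h | h | h
    · exact (hlt α β h heq').elim
    · exact h
    · exact (hlt β α h heq'.symm).elim
  exact hinj.uncountable

/-- The nonzero cells, ordered by reverse inclusion. -/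
def CellTree (r : Ordinal.{0} → B) : Type := (cells r)ᵒᵈ

instance (r : Ordinal.{0} → B) : PartialOrder (CellTree r) :=
  inferInstanceAs (PartialOrder (cells r)ᵒᵈ)

/-- The element of the algebra underlying a node of the tree. -/
def CellTree.val {r : Ordinal.{0} → B} (t : CellTree r) : B := (OrderDual.ofDual t).1

lemma CellTree.val_mem {r : Ordinal.{0} → B} (t : CellTree r) : t.val ∈ cells r :=
  (OrderDual.ofDual t).2

lemma CellTree.val_injective (r : Ordinal.{0} → B) :
    Function.Injective (CellTree.val : CellTree r → B) := Subtype.val_injective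

lemma CellTree.lt_iff {r : Ordinal.{0} → B} {s t : CellTree r} : s < t ↔ t.val < s.val := Iff.rfl

lemma CellTree.isWellOrder {r : Ordinal.{0} → B} (t : CellTree r) :
    IsWellOrder {s : CellTree r // s < t} (fun a b => a.1 < b.1) := by
  obtain ⟨h0, x, α, ht⟩ := t.val_mem
  have hex : ∀ s : {s : CellTree r // s < t}, ∃ β, s.1.val = cell r x β := fun s => by
    obtain ⟨β, -, h⟩ := exists_lt_eq_cell (ht ▸ h0) s.1.val_mem (ht ▸ CellTree.lt_iff.1 s.2)
    exact ⟨β, h⟩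
  choose idx hidx using hex
  have hmono : ∀ a b, a.1 < b.1 → idx a < idx b := fun a b h => by
    by_contra! hle
    have := cell_antitone r x hle
    rw [← hidx, ← hidx] at this
    exact absurd this (CellTree.lt_iff.1 h).not_ge
  refine { wf := ?_, trichotomous := ?_ }
  · exact Subrelation.wf (fun {a b} h => hmono a b h) (InvImage.wf idx wellFounded_lt)
  · intro a b hab hba
    refine Subtype.ext (CellTree.val_injective r ?_)
    rw [CellTree.lt_iff] at hab hba
    rcases le_total (idx a) (idx b) with h | h <;> have := cell_antitone r x h <;>
      rw [← hidx, ← hidx] at this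
    · exact (this.eq_of_not_lt hab).symm
    · exact this.eq_of_not_lt hba

end

end SouslinOfDistributive

open SouslinOfDistributive

/-- If there is a nontrivial atomless c.c.c. `(ω,ω)`-distributive complete Boolean
algebra, then there is a Souslin tree. -/
theorem souslin_tree_of_ccc_distributive_cBa
    (h : ∃ (B : Type) (_ : CompleteBooleanAlgebra B),
      (⊥ : B) ≠ ⊤ ∧
      (∀ b : B, b ≠ ⊥ → ∃ c : B, c ≠ ⊥ ∧ c ≤ b ∧ c ≠ b) ∧
      (∀ A : Set B, (∀ a ∈ A, a ≠ ⊥) → A.Pairwise (fun a b => a ⊓ b = ⊥) → A.Countable) ∧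
      (∀ a : ℕ → ℕ → B, ⨅ n, ⨆ m, a n m = ⨆ f : ℕ → ℕ, ⨅ n, a n (f n))) :
    ∃ (T : Type) (_ : PartialOrder T), IsSouslinTree T := by
  obtain ⟨B, _, hB, hatomless, hccc, hd⟩ := h
  obtain ⟨r, hr⟩ := exists_splits hatomless
  refine ⟨CellTree r, inferInstance, uncountable_cells hr hB hd, CellTree.isWellOrder, ?_, ?_⟩
  · intro C hC
    refine Set.countable_of_injective_of_countable_image (CellTree.val_injective r).injOn
      (countable_of_chain hr hccc ?_ ?_)
    · rintro _ ⟨t, -, rfl⟩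
      exact t.val_mem
    · rintro _ ⟨t, ht, rfl⟩ _ ⟨u, hu, rfl⟩ hne
      exact (hC t ht u hu fun h => hne (h ▸ rfl)).symm
  · intro A hA
    refine Set.countable_of_injective_of_countable_image (CellTree.val_injective r).injOn
      (hccc _ ?_ ?_)
    · rintro _ ⟨t, -, rfl⟩
      exact t.val_mem.1
    · rintro _ ⟨t, ht, rfl⟩ _ ⟨u, hu, rfl⟩ hne
      have hinc := hA t ht u hu fun h => hne (h ▸ rfl)
      rw [CellTree.lt_iff, CellTree.lt_iff] at hinc
      rcases le_or_le_or_disjoint_of_mem_cells t.val_mem u.val_mem with h | h | h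
      · exact absurd (h.lt_of_ne hne) hinc.2
      · exact absurd (h.lt_of_ne hne.symm) hinc.1
      · exact h.eq_bot
end

section
/- If there exists a Souslin tree, then there exists a nontrivial complete Boolean algebra B (with ⊥ ≠ ⊤) which is atomless (every b ≠ ⊥ has some c with ⊥ ≠ c ≤ b and c ≠ b), satisfies the countable chain condition, and is (ω,ω)-distributive. -/
open Heyting in
/-- The regular elements of a frame form a complete Boolean algebra. -/
noncomputable abbrev Heyting.Regular.completeBooleanAlgebra (α : Type*) [Order.Frame α] :
    CompleteBooleanAlgebra (Regular α) :=
  { (inferInstance : BooleanAlgebra (Regular α)) with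
    sSup := fun s => Regular.toRegular (sSup (Regular.val '' s))
    sInf := fun s => Regular.toRegular (sInf (Regular.val '' s))
    isLUB_sSup := fun _ => Regular.gi.isLUB_of_u_image (isLUB_sSup _)
    isGLB_sInf := fun _ => Regular.gi.isGLB_of_u_image (isGLB_sInf _) }

section RegularLowerSet

open Heyting

variable {Q : Type*} [Preorder Q]

attribute [local instance] Heyting.Regular.completeBooleanAlgebra

theorem LowerSet.mem_heyting_compl_iff {a : LowerSet Q} {p : Q} :
    p ∈ (aᶜ : LowerSet Q) ↔ ∀ q ≤ p, q ∉ a := by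
  rw [← LowerSet.Iic_le, le_compl_iff_disjoint_right, disjoint_iff_inf_le]
  constructor
  · intro h q hq hqa
    exact h (show q ∈ LowerSet.Iic p ⊓ a from ⟨hq, hqa⟩)
  · rintro h q ⟨hq, hqa⟩
    exact (h q hq hqa).elim

theorem LowerSet.mem_heyting_compl_compl_iff {a : LowerSet Q} {p : Q} :
    p ∈ (aᶜᶜ : LowerSet Q) ↔ ∀ q ≤ p, ∃ r ≤ q, r ∈ a := by
  simp only [LowerSet.mem_heyting_compl_iff, not_forall, not_not, exists_prop]

theorem Heyting.Regular.mem_of_dense_below {b : Regular (LowerSet Q)} {p : Q}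
    (h : ∀ q ≤ p, ∃ r ≤ q, r ∈ b.val) : p ∈ b.val := by
  rw [← b.prop.eq]
  exact LowerSet.mem_heyting_compl_compl_iff.2 h

theorem Heyting.Regular.le_of_forall_mem {b c : Regular (LowerSet Q)}
    (h : ∀ p ∈ b.val, ∃ r ≤ p, r ∈ c.val) : b ≤ c := by
  refine Regular.coe_le_coe.1 fun p hp => Regular.mem_of_dense_below fun q hq => ?_
  exact h q (b.val.lower hq hp)

theorem Heyting.Regular.exists_mem_of_ne_bot {b : Regular (LowerSet Q)} (h : b ≠ ⊥) :
    ∃ p, p ∈ b.val := by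
  by_contra! hb
  exact h (le_bot_iff.1 (Regular.le_of_forall_mem fun p hp => (hb p hp).elim))

theorem Heyting.Regular.ne_bot_of_mem {b : Regular (LowerSet Q)} {p : Q} (h : p ∈ b.val) :
    b ≠ ⊥ := by
  rintro rfl
  exact h

theorem Heyting.Regular.exists_mem_of_mem_iSup {ι : Sort*} {b : ι → Regular (LowerSet Q)} {p : Q}
    (h : p ∈ (⨆ i, b i).val) : ∃ r ≤ p, ∃ i, r ∈ (b i).val := by
  obtain ⟨r, hr, hrb⟩ := LowerSet.mem_heyting_compl_compl_iff.1 h p le_rfl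
  obtain ⟨_, ⟨_, ⟨i, rfl⟩, rfl⟩, hi⟩ := LowerSet.mem_sSup_iff.1 hrb
  exact ⟨r, hr, i, hi⟩

theorem Heyting.Regular.mem_iInf_of_forall {ι : Sort*} {b : ι → Regular (LowerSet Q)} {p : Q}
    (h : ∀ i, p ∈ (b i).val) : p ∈ (⨅ i, b i).val := by
  refine le_compl_compl (a := sInf (Regular.val '' Set.range b)) ?_
  rintro _ ⟨_, rfl⟩
  simp only [Set.mem_iInter]
  rintro ⟨_, ⟨i, rfl⟩, rfl⟩
  exact h i

/-- If countably many open dense sets below a condition always have a common element below that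
condition, then the regular open algebra is `(ω,ω)`-distributive. -/
theorem Heyting.Regular.iInf_iSup_eq_of_baire
    (hQ : ∀ (p : Q) (D : ℕ → LowerSet Q), (∀ n, ∀ q ≤ p, ∃ r ≤ q, r ∈ D n) →
      ∃ q ≤ p, ∀ n, q ∈ D n)
    (a : ℕ → ℕ → Regular (LowerSet Q)) :
    ⨅ n, ⨆ m, a n m = ⨆ f : ℕ → ℕ, ⨅ n, a n (f n) := by
  refine le_antisymm (Regular.le_of_forall_mem fun p hp => ?_)
    (iSup_le fun f => iInf_mono fun n => le_iSup (a n) (f n))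
  obtain ⟨q, hqp, hq⟩ := hQ p (fun n => ⨆ m, (a n m).val) fun n q hq => by
    have hqn : q ∈ (⨆ m, a n m).val :=
      Regular.coe_le_coe.2 (iInf_le (fun n => ⨆ m, a n m) n)
        ((⨅ n, ⨆ m, a n m).val.lower hq hp)
    obtain ⟨r, hr, m, hm⟩ := Regular.exists_mem_of_mem_iSup hqn
    exact ⟨r, hr, LowerSet.mem_iSup_iff.2 ⟨m, hm⟩⟩
  choose f hf using fun n => LowerSet.mem_iSup_iff.1 (hq n)
  exact ⟨q, hqp, Regular.coe_le_coe.2 (le_iSup (fun f : ℕ → ℕ => ⨅ n, a n (f n)) f)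
    (Regular.mem_iInf_of_forall hf)⟩

/-- If every condition has two incompatible extensions, then the regular open algebra is
atomless. -/
theorem Heyting.Regular.exists_lt_of_forall_exists_incompatible
    (hQ : ∀ p : Q, ∃ q ≤ p, ∃ r ≤ p, ∀ s ≤ q, ¬ s ≤ r)
    {b : Regular (LowerSet Q)} (hb : b ≠ ⊥) : ∃ c, c ≠ ⊥ ∧ c ≤ b ∧ c ≠ b := by
  obtain ⟨p, hp⟩ := Regular.exists_mem_of_ne_bot hb
  obtain ⟨q, hq, r, hr, hqr⟩ := hQ p
  refine ⟨Regular.toRegular (LowerSet.Iic q), Regular.ne_bot_of_mem (p := q) ?_, ?_, ?_⟩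
  · exact le_compl_compl (a := LowerSet.Iic q) (le_refl q)
  · exact Regular.gi.gc.l_le (LowerSet.Iic_le.2 (b.val.lower hq hp))
  · intro h
    have hrb : r ∈ ((LowerSet.Iic q)ᶜᶜ : LowerSet Q) := by
      rw [← Regular.coe_toRegular, h]
      exact b.val.lower hr hp
    obtain ⟨s, hsr, hsq⟩ := LowerSet.mem_heyting_compl_compl_iff.1 hrb r le_rfl
    exact hqr s hsq hsr

/-- If sets of pairwise incompatible conditions are countable, then so are sets of pairwise
disjoint nonzero elements of the regular open algebra. -/
theorem Heyting.Regular.countable_of_pairwise_inf_eq_bot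
    (hQ : ∀ A : Set Q, A.Pairwise (fun p q => ∀ s ≤ p, ¬ s ≤ q) → A.Countable)
    {A : Set (Regular (LowerSet Q))} (hA : ∀ a ∈ A, a ≠ ⊥)
    (hd : A.Pairwise fun a b => a ⊓ b = ⊥) : A.Countable := by
  choose u hu using fun a : A => Regular.exists_mem_of_ne_bot (hA a a.2)
  have key : ∀ a b : A, a ≠ b → ∀ s ≤ u a, ¬ s ≤ u b := by
    intro a b hab s hsa hsb
    refine Regular.ne_bot_of_mem (b := a.1 ⊓ b.1) (p := s) ?_
      (hd a.2 b.2 fun h => hab (Subtype.ext h))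
    exact ⟨a.1.val.lower hsa (hu a), b.1.val.lower hsb (hu b)⟩
  have hinj : Function.Injective u := by
    intro a b hab
    by_contra hne
    exact key a b hne (u a) le_rfl hab.le
  have hrange : (Set.range u).Countable := by
    refine hQ _ ?_
    rintro _ ⟨a, rfl⟩ _ ⟨b, rfl⟩ hne
    exact key a b fun h => hne (congrArg u h)
  rw [← Set.image_univ] at hrange
  exact Set.countable_coe_iff.1
    (Set.countable_univ_iff.1 (Set.countable_of_injective_of_countable_image hinj.injOn hrange))

end RegularLowerSet

namespace IsSouslinTree

variable {T : Type} [PartialOrder T]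

theorem wellFounded_lt (hT : IsSouslinTree T) : WellFounded ((· < ·) : T → T → Prop) := by
  refine WellFounded.wellFounded_iff_has_min.2 fun S ⟨t, ht⟩ => ?_
  by_cases hmin : ∃ s ∈ S, s < t
  · obtain ⟨s, hs, hst⟩ := hmin
    have := hT.2.1 t
    obtain ⟨m, hmS, hm⟩ := (IsWellFounded.wf (r := fun a b : {s : T // s < t} => a.1 < b.1)).has_min
      {x | x.1 ∈ S} ⟨⟨s, hst⟩, hs⟩
    exact ⟨m, hmS, fun x hx hxm => hm ⟨x, hxm.trans m.2⟩ hx hxm⟩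
  · exact ⟨t, ht, fun x hx hxt => hmin ⟨x, hx, hxt⟩⟩

theorem le_total_of_le (hT : IsSouslinTree T) {a b t : T} (ha : a ≤ t) (hb : b ≤ t) :
    a ≤ b ∨ b ≤ a := by
  rcases ha.eq_or_lt with rfl | ha
  · exact Or.inr hb
  rcases hb.eq_or_lt with rfl | hb
  · exact Or.inl ha.le
  have := hT.2.1 t
  rcases trichotomous_of (fun a b : {s : T // s < t} => a.1 < b.1) ⟨a, ha⟩ ⟨b, hb⟩ with h | h | h
  · exact Or.inl h.le
  · exact Or.inl (congrArg Subtype.val h).le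
  · exact Or.inr h.le

theorem countable_of_isChain (hT : IsSouslinTree T) {C : Set T}
    (hC : ∀ a ∈ C, ∀ b ∈ C, a ≤ b ∨ b ≤ a) : C.Countable :=
  hT.2.2.1 C fun a ha b hb hab =>
    (hC a ha b hb).imp (fun h => h.lt_of_ne hab) (fun h => h.lt_of_ne hab.symm)

theorem countable_Iic (hT : IsSouslinTree T) (t : T) : (Set.Iic t).Countable :=
  hT.countable_of_isChain fun _ ha _ hb => hT.le_total_of_le ha hb

/-- The elements of `S` that are minimal in `S` form a countable set. -/
theorem countable_minimal (hT : IsSouslinTree T) (S : Set T) :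
    {t | Minimal (· ∈ S) t}.Countable :=
  hT.2.2.2 _ fun _ ha _ hb _ => ⟨hb.not_lt ha.1, ha.not_lt hb.1⟩

theorem exists_minimal_le (hT : IsSouslinTree T) {S : Set T} {t : T} (ht : t ∈ S) :
    ∃ m ≤ t, Minimal (· ∈ S) m := by
  obtain ⟨m, ⟨hmS, hmt⟩, hm⟩ := hT.wellFounded_lt.has_min {s | s ∈ S ∧ s ≤ t} ⟨t, ht, le_rfl⟩
  refine ⟨m, hmt, hmS, fun x hx hxm => ?_⟩
  by_contra h
  exact hm x ⟨hx, hxm.trans hmt⟩ (lt_of_le_not_ge hxm h)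

theorem countable_setOf_countable_Ici (hT : IsSouslinTree T) :
    {t : T | (Set.Ici t).Countable}.Countable := by
  set S := {t : T | (Set.Ici t).Countable}
  refine ((hT.countable_minimal S).biUnion fun m hm => hm.1).mono fun t ht => ?_
  obtain ⟨m, hmt, hm⟩ := hT.exists_minimal_le ht
  exact Set.mem_biUnion hm hmt

/-- The subtree of elements with uncountably many elements above them is a Souslin tree. -/
theorem subtype_not_countable_Ici (hT : IsSouslinTree T) :
    IsSouslinTree {t : T // ¬ (Set.Ici t).Countable} := by
  refine ⟨?_, fun t => ?_, fun C hC => ?_, fun A hA => ?_⟩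
  · rw [← not_countable_iff]
    intro hc
    have h : {t : T | ¬ (Set.Ici t).Countable}.Countable := Set.countable_coe_iff.1 hc
    have huniv := h.union hT.countable_setOf_countable_Ici
    refine hT.1.not_countable (Set.countable_univ_iff.1 (huniv.mono fun t _ => ?_))
    exact (em _).symm
  · have := hT.2.1 t.1
    let f : {s : {t : T // ¬ (Set.Ici t).Countable} // s < t} ↪ {s : T // s < t.1} :=
      ⟨fun s => ⟨s.1.1, s.2⟩, fun a b h =>
        Subtype.ext (Subtype.ext (Subtype.mk.inj h))⟩
    exact (RelEmbedding.mk (s := fun a b : {s : T // s < t.1} => a.1 < b.1)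
      (r := fun a b : {s : {t : T // ¬ (Set.Ici t).Countable} // s < t} => a.1 < b.1)
      f Iff.rfl).isWellOrder
  · refine Set.countable_of_injective_of_countable_image Subtype.val_injective.injOn
      (hT.2.2.1 _ ?_)
    rintro _ ⟨a, ha, rfl⟩ _ ⟨b, hb, rfl⟩ hab
    exact hC a ha b hb fun h => hab (congrArg _ h)
  · refine Set.countable_of_injective_of_countable_image Subtype.val_injective.injOn
      (hT.2.2.2 _ ?_)
    rintro _ ⟨a, ha, rfl⟩ _ ⟨b, hb, rfl⟩ hab
    exact hA a ha b hb fun h => hab (congrArg _ h)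

theorem not_countable_Ici_subtype (hT : IsSouslinTree T)
    (t : {t : T // ¬ (Set.Ici t).Countable}) : ¬ (Set.Ici t).Countable := by
  intro h
  refine t.2 (((h.image Subtype.val).union hT.countable_setOf_countable_Ici).mono fun s hs => ?_)
  by_cases hc : (Set.Ici s).Countable
  · exact Or.inr hc
  · exact Or.inl ⟨⟨s, hc⟩, hs, rfl⟩

theorem exists_incompatible_ge (hT : IsSouslinTree T) {t : T} (ht : ¬ (Set.Ici t).Countable) :
    ∃ q ≥ t, ∃ r ≥ t, ∀ s ≥ q, ¬ r ≤ s := by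
  by_contra! h
  refine ht (hT.countable_of_isChain fun a ha b hb => ?_)
  obtain ⟨s, hs, hbs⟩ := h a ha b hb
  exact hT.le_total_of_le hs hbs

theorem countable_of_pairwise_incompatible (hT : IsSouslinTree T) {A : Set T}
    (hA : A.Pairwise fun p q => ∀ s ≥ p, ¬ q ≤ s) : A.Countable :=
  hT.2.2.2 A fun a ha b hb hab =>
    ⟨fun h => hA ha hb hab b h.le le_rfl, fun h => hA ha hb hab a le_rfl h.le⟩

/-- Countably many upper sets that are dense above `t` have a common element above `t`. -/
theorem exists_ge_forall_mem (hT : IsSouslinTree T) {t : T} (ht : ¬ (Set.Ici t).Countable)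
    {D : ℕ → Set T} (hup : ∀ n, IsUpperSet (D n)) (hD : ∀ n, ∀ q ≥ t, ∃ r ≥ q, r ∈ D n) :
    ∃ q ≥ t, ∀ n, q ∈ D n := by
  have hc : (⋃ n, ⋃ m ∈ {m | Minimal (· ∈ D n) m}, Set.Iic m).Countable :=
    Set.countable_iUnion fun n =>
      (hT.countable_minimal (D n)).biUnion fun m _ => hT.countable_Iic m
  obtain ⟨q, hq, hqD⟩ := Set.not_subset.1 fun hsub => ht (hc.mono hsub)
  refine ⟨q, hq, fun n => ?_⟩
  obtain ⟨r, hrq, hr⟩ := hD n q hq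
  obtain ⟨m, hmr, hm⟩ := hT.exists_minimal_le hr
  rcases hT.le_total_of_le hrq hmr with h | h
  · exact (hqD (Set.mem_iUnion.2 ⟨n, Set.mem_biUnion hm h⟩)).elim
  · exact hup n h hm.1

end IsSouslinTree

/-- If there is a Souslin tree, then there is a nontrivial atomless c.c.c.
`(ω,ω)`-distributive complete Boolean algebra. -/
theorem ccc_distributive_cBa_of_souslin_tree
    (h : ∃ (T : Type) (_ : PartialOrder T), IsSouslinTree T) :
    ∃ (B : Type) (_ : CompleteBooleanAlgebra B),
      (⊥ : B) ≠ ⊤ ∧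
      (∀ b : B, b ≠ ⊥ → ∃ c : B, c ≠ ⊥ ∧ c ≤ b ∧ c ≠ b) ∧
      (∀ A : Set B, (∀ a ∈ A, a ≠ ⊥) → A.Pairwise (fun a b => a ⊓ b = ⊥) → A.Countable) ∧
      (∀ a : ℕ → ℕ → B, ⨅ n, ⨆ m, a n m = ⨆ f : ℕ → ℕ, ⨅ n, a n (f n)) := by
  obtain ⟨T, _, hT⟩ := h
  obtain ⟨P, _, hP, hcone⟩ : ∃ (P : Type) (_ : PartialOrder P), IsSouslinTree P ∧
      ∀ p : P, ¬ (Set.Ici p).Countable :=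
    ⟨_, _, hT.subtype_not_countable_Ici, hT.not_countable_Ici_subtype⟩
  refine ⟨Heyting.Regular (LowerSet Pᵒᵈ), Heyting.Regular.completeBooleanAlgebra _,
    ?_, fun b hb => ?_, fun A hA hd => ?_, fun a => ?_⟩
  · have := hP.1
    obtain ⟨p⟩ : Nonempty P := inferInstance
    have hp : OrderDual.toDual p ∈ (⊤ : Heyting.Regular (LowerSet Pᵒᵈ)).val := trivial
    exact (Heyting.Regular.ne_bot_of_mem hp).symm
  · exact Heyting.Regular.exists_lt_of_forall_exists_incompatible (Q := Pᵒᵈ)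
      (fun p => hP.exists_incompatible_ge (hcone p.ofDual)) hb
  · exact Heyting.Regular.countable_of_pairwise_inf_eq_bot (Q := Pᵒᵈ)
      (fun _ hA => hP.countable_of_pairwise_incompatible hA) hA hd
  · exact Heyting.Regular.iInf_iSup_eq_of_baire (Q := Pᵒᵈ)
      (fun p D hD => hP.exists_ge_forall_mem (hcone p.ofDual) (D := fun n => (D n : Set Pᵒᵈ))
        (fun n _ _ hab ha => (D n).lower hab ha) hD) a
end

section
/- Let B be a complete Boolean algebra satisfying the countable chain condition. If B is (ω,ω)-distributive, then B is (ω,∞)-distributive; that is, for every set I and every family ⟨a(n,i) : n < ω, i ∈ I⟩ of elements of B one has ⨅_{n<ω} ⨆_{i∈I} a(n,i) = ⨆_{f : ω→I} ⨅_{n<ω} a(n, f(n)). -/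
/-- In a c.c.c. complete Boolean algebra, the supremum of a nonempty family is bounded by the
supremum of a countable subfamily. -/
theorem exists_seq_iSup_le_of_ccc {B I : Type*} [CompleteBooleanAlgebra B] [Nonempty I]
    (hccc : ∀ A : Set B, (∀ a ∈ A, a ≠ ⊥) → A.Pairwise (fun a b => a ⊓ b = ⊥) → A.Countable)
    (b : I → B) : ∃ g : ℕ → I, ⨆ i, b i ≤ ⨆ m, b (g m) := by
  obtain ⟨_, _⟩ := exists_wellFoundedLT I
  let c : I → B := fun i => b i \ ⨆ j : Set.Iio i, b j
  have hlt : ∀ i j, i < j → Disjoint (c i) (c j) := fun i j hij =>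
    disjoint_sdiff_self_right.mono_left
      (sdiff_le.trans (le_iSup (fun k : Set.Iio j => b k) ⟨i, hij⟩))
  have hdisj : Pairwise (Function.onFun Disjoint c) := fun i j hij =>
    hij.lt_or_gt.elim (hlt i j) fun h => (hlt j i h).symm
  let S : Set I := {i | c i ≠ ⊥}
  have hinj : S.InjOn c := by
    intro i hi j _ hij
    by_contra hne
    have h : Disjoint (c i) (c j) := hdisj hne
    rw [← hij, disjoint_self] at h
    exact hi h
  have himage : (c '' S).Countable := by
    refine hccc _ ?_ ?_
    · rintro _ ⟨i, hi, rfl⟩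
      exact hi
    · rintro _ ⟨i, _, rfl⟩ _ ⟨j, _, rfl⟩ hne
      exact (hdisj (ne_of_apply_ne c hne)).eq_bot
  have hS : S.Countable := Set.countable_of_injective_of_countable_image hinj himage
  obtain ⟨g, hg⟩ := (hS.insert (Classical.arbitrary I)).exists_eq_range (Set.insert_nonempty _ _)
  refine ⟨g, iSup_le fun i => ?_⟩
  induction i using WellFoundedLT.induction with
  | ind i ih =>
    by_cases hi : c i = ⊥
    · exact (sdiff_eq_bot_iff.mp hi).trans (iSup_le fun j => ih j j.2)
    · have hmem : i ∈ Set.range g := hg ▸ Set.mem_insert_of_mem _ hi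
      obtain ⟨m, rfl⟩ := hmem
      exact le_iSup (fun m => b (g m)) m

/-- In a c.c.c. complete Boolean algebra, `(ω,ω)`-distributivity implies
`(ω,∞)`-distributivity. -/
theorem omega_infty_distributive_of_omega_omega_distributive
    {B : Type*} [CompleteBooleanAlgebra B]
    (hccc : ∀ A : Set B, (∀ a ∈ A, a ≠ ⊥) → A.Pairwise (fun a b => a ⊓ b = ⊥) → A.Countable)
    (hdist : ∀ a : ℕ → ℕ → B, ⨅ n, ⨆ m, a n m = ⨆ f : ℕ → ℕ, ⨅ n, a n (f n))
    (I : Type*) (a : ℕ → I → B) :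
    ⨅ n, ⨆ i, a n i = ⨆ f : ℕ → I, ⨅ n, a n (f n) := by
  apply le_antisymm
  · cases isEmpty_or_nonempty I
    · exact (iInf_le _ 0).trans (by simp)
    · choose g hg using fun n => exists_seq_iSup_le_of_ccc hccc (a n)
      calc ⨅ n, ⨆ i, a n i ≤ ⨅ n, ⨆ m, a n (g n m) := iInf_mono hg
        _ = ⨆ f : ℕ → ℕ, ⨅ n, a n (g n (f n)) := hdist _
        _ ≤ ⨆ f : ℕ → I, ⨅ n, a n (f n) :=
          iSup_le fun f => le_iSup (fun h : ℕ → I => ⨅ n, a n (h n)) fun n => g n (f n)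
  · exact iSup_le fun f => iInf_mono fun n => le_iSup (a n) (f n)
end

section
/- Let κ be an infinite cardinal and let P be a κ⁺-closed partial order in which every element has two incompatible extensions (for every p ∈ P there are q₁, q₂ ≤ p with q₁ and q₂ incompatible). Then for every p ∈ P there exists a family A of pairwise incompatible elements of P, each ≤ p, with |A| = 2^κ. -/
universe u v

/-- A partial order is `κ`-closed if every `≤`-decreasing sequence of elements indexed by
an ordinal `η < κ` (i.e. `η < κ.ord`) has a lower bound. -/
def IsKappaClosed (P : Type v) [Preorder P] (κ : Cardinal.{u}) : Prop :=
  ∀ η : Ordinal.{u}, η < κ.ord → ∀ p : Ordinal.{u} → P,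
    (∀ i j : Ordinal.{u}, i ≤ j → j < η → p j ≤ p i) →
    ∃ q : P, ∀ i : Ordinal.{u}, i < η → q ≤ p i

/-- Two elements of a partial order are incompatible if they have no common lower bound. -/
def Incompat {P : Type v} [Preorder P] (p q : P) : Prop :=
  ¬ ∃ r : P, r ≤ p ∧ r ≤ q

theorem Incompat.symm {P : Type v} [Preorder P] {p q : P} (h : Incompat p q) :
    Incompat q p :=
  fun ⟨r, hq, hp⟩ => h ⟨r, hp, hq⟩

theorem Incompat.ne {P : Type v} [Preorder P] {p q : P} (h : Incompat p q) : p ≠ q := by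
  rintro rfl
  exact h ⟨p, le_rfl, le_rfl⟩

theorem Incompat.mono {P : Type v} [Preorder P] {p q a b : P} (h : Incompat p q)
    (hp : a ≤ p) (hq : b ≤ q) : Incompat a b :=
  fun ⟨r, hrp, hrq⟩ => h ⟨r, hrp.trans hp, hrq.trans hq⟩

/-- `x` lies below `p` and below the extensions, chosen by `ext` along the branch `f`, of all
nodes `s β` with `β < α`. -/
def IsBranchBound {P : Type v} [Preorder P] (ext : Prop → P → P) (p : P)
    (f : Ordinal.{u} → Prop) (α : Ordinal.{u}) (s : ∀ β < α, P) (x : P) : Prop :=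
  x ≤ p ∧ ∀ β (h : β < α), x ≤ ext (f β) (s β h)

open Classical in
/-- The node at level `α` of the binary tree below `p` generated by `ext`, along the branch `f`.
Its value is `p` if the nodes below `α` cannot be continued. -/
noncomputable def branchNode {P : Type v} [Preorder P] (ext : Prop → P → P) (p : P)
    (f : Ordinal.{u} → Prop) (α : Ordinal.{u}) : P :=
  if h : ∃ x, IsBranchBound ext p f α (fun β _ => branchNode ext p f β) x then h.choose else p
termination_by α

theorem branchNode_congr {P : Type v} [Preorder P] (ext : Prop → P → P) (p : P)
    {f g : Ordinal.{u} → Prop} (α : Ordinal.{u}) (hfg : ∀ β < α, f β = g β) :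
    branchNode ext p f α = branchNode ext p g α := by
  induction α using WellFoundedLT.induction with
  | ind α ih =>
    have key : IsBranchBound ext p f α (fun β _ => branchNode ext p f β) =
        IsBranchBound ext p g α (fun β _ => branchNode ext p g β) := by
      funext x
      unfold IsBranchBound
      refine congrArg (x ≤ p ∧ ·) (forall_congr fun β => forall_congr fun h => ?_)
      simp only [hfg β h, ih β h fun γ hγ => hfg γ (hγ.trans h)]
    rw [branchNode, branchNode, key]

theorem isBranchBound_branchNode {P : Type v} [Preorder P] {κ : Cardinal.{u}}
    (hclosed : IsKappaClosed P κ) {ext : Prop → P → P} (hext : ∀ b q, ext b q ≤ q) (p : P)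
    (f : Ordinal.{u} → Prop) (α : Ordinal.{u}) (hα : α < κ.ord) :
    IsBranchBound ext p f α (fun β _ => branchNode ext p f β) (branchNode ext p f α) := by
  induction α using WellFoundedLT.induction with
  | ind α ih =>
    have hex : ∃ x, IsBranchBound ext p f α (fun β _ => branchNode ext p f β) x := by
      obtain ⟨q, hq⟩ := hclosed α hα (fun β => ext (f β) (branchNode ext p f β)) (by
        intro i j hij hj
        rcases hij.eq_or_lt with rfl | hij
        · exact le_rfl
        · exact (hext _ _).trans ((ih j hj (hj.trans hα)).2 i hij))
      rcases eq_or_ne α 0 with rfl | h0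
      · exact ⟨p, le_rfl, fun β h => absurd h not_lt_zero⟩
      · have hpos : 0 < α := pos_iff_ne_zero.2 h0
        exact ⟨q, ((hq 0 hpos).trans (hext _ _)).trans (ih 0 hpos (hpos.trans hα)).1, hq⟩
    rw [branchNode, dif_pos hex]
    exact hex.choose_spec

theorem incompat_branchNode {P : Type v} [Preorder P] {κ : Cardinal.{u}}
    (hclosed : IsKappaClosed P κ) {ext : Prop → P → P} (hext : ∀ b q, ext b q ≤ q)
    (hinc : ∀ b c q, b ≠ c → Incompat (ext b q) (ext c q)) (p : P)
    {f g : Ordinal.{u} → Prop} {α : Ordinal.{u}} (hα : α < κ.ord)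
    (hfg : ∃ β < α, f β ≠ g β) :
    Incompat (branchNode ext p f α) (branchNode ext p g α) := by
  obtain ⟨β, ⟨hβα, hne⟩, hmin⟩ := WellFounded.has_min (wellFounded_lt (α := Ordinal.{u}))
    {β | β < α ∧ f β ≠ g β} hfg
  have heq : branchNode ext p f β = branchNode ext p g β :=
    branchNode_congr ext p β fun γ hγ => by
      by_contra h
      exact hmin γ ⟨hγ.trans hβα, h⟩ hγ
  have hf := (isBranchBound_branchNode hclosed hext p f α hα).2 β hβα
  have hg := (isBranchBound_branchNode hclosed hext p g α hα).2 β hβα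
  simp only [← heq] at hg
  exact (hinc _ _ _ hne).mono hf hg

theorem exists_incompat_extension {P : Type v} [Preorder P]
    (hsplit : ∀ p : P, ∃ q₁ q₂ : P, q₁ ≤ p ∧ q₂ ≤ p ∧ Incompat q₁ q₂) :
    ∃ ext : Prop → P → P, (∀ b q, ext b q ≤ q) ∧
      ∀ b c q, b ≠ c → Incompat (ext b q) (ext c q) := by
  classical
  choose l r hl hr hlr using hsplit
  refine ⟨fun b q => if b then l q else r q, fun b q => ?_, fun b c q hbc => ?_⟩
  · by_cases hb : b <;> simp [hb, hl, hr]
  · by_cases hb : b <;> by_cases hc : c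
    · exact absurd (propext (iff_of_true hb hc)) hbc
    · simpa [hb, hc] using hlr q
    · simpa [hb, hc] using (hlr q).symm
    · exact absurd (propext (iff_of_false hb hc)) hbc

/-- If `κ` is an infinite cardinal and `P` is a `κ⁺`-closed partial order in which every
element has two incompatible extensions, then below every `p ∈ P` there is a family of
`2 ^ κ` pairwise incompatible elements. -/
theorem antichain_of_size_two_pow_of_succ_closed {P : Type u} [PartialOrder P]
    (κ : Cardinal.{u}) (hκ : Cardinal.aleph0 ≤ κ)
    (hclosed : IsKappaClosed P (Order.succ κ))
    (hsplit : ∀ p : P, ∃ q₁ q₂ : P, q₁ ≤ p ∧ q₂ ≤ p ∧ Incompat q₁ q₂)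
    (p : P) :
    ∃ A : Set P, (∀ a ∈ A, a ≤ p) ∧
      A.Pairwise (fun a b => Incompat a b) ∧ Cardinal.mk A = 2 ^ κ := by
  obtain ⟨ext, hext, hinc⟩ := exists_incompat_extension hsplit
  have hlt : κ.ord < (Order.succ κ).ord := Cardinal.ord_lt_ord.2 (Order.lt_succ κ)
  let e : κ.ord.ToType → Ordinal.{u} := Ordinal.typein (· < ·)
  let node (S : Set κ.ord.ToType) : P := branchNode ext p (fun β => β ∈ Set.image e S) κ.ord
  have hnode : ∀ S T, S ≠ T → Incompat (node S) (node T) := by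
    intro S T hST
    refine incompat_branchNode hclosed hext hinc p hlt ?_
    by_contra! h
    refine hST (Set.ext fun x => ?_)
    have he : Function.Injective e := Ordinal.typein_injective _
    have hx := h (e x) (Ordinal.typein_lt_self x)
    rwa [he.mem_set_image, he.mem_set_image, eq_iff_iff] at hx
  have hinj : Function.Injective node := fun S T h => by
    by_contra hST
    exact (hnode S T hST).ne h
  refine ⟨Set.range node, ?_, ?_, ?_⟩
  · rintro _ ⟨S, rfl⟩
    exact (isBranchBound_branchNode hclosed hext p _ κ.ord hlt).1
  · rintro _ ⟨S, rfl⟩ _ ⟨T, rfl⟩ hne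
    exact hnode S T fun h => hne (congrArg node h)
  · rw [Cardinal.mk_range_eq node hinj, Cardinal.mk_set, Cardinal.mk_ord_toType]
end

section
/- The partial order P(μ,λ) is μ-closed: every ≤-decreasing sequence ⟨p_i : i < η⟩ of elements of P(μ,λ) indexed by an ordinal η < μ has a lower bound in P(μ,λ). -/
/-- `c` is unbounded in `β`. -/
def UnboundedIn (c : Set Ordinal) (β : Ordinal) : Prop :=
  ∀ γ < β, ∃ x ∈ c, γ ≤ x ∧ x < β

/-- `c` is closed in `β`: it contains each of its limit points below `β`. -/
def ClosedIn (c : Set Ordinal) (β : Ordinal) : Prop :=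
  ∀ γ < β, 0 < γ → (∀ δ < γ, ∃ x ∈ c, δ < x ∧ x < γ) → γ ∈ c

/-- `A` is non-stationary in `β`: some subset of `β` which is closed and unbounded in `β`
is disjoint from `A`. -/
def NonStationaryIn (A : Set Ordinal) (β : Ordinal) : Prop :=
  ∃ c : Set Ordinal, (∀ x ∈ c, x < β) ∧ UnboundedIn c β ∧ ClosedIn c β ∧ Disjoint c A

/-- A condition in the forcing `P(μ,λ)`: a function `p : S ∩ α → 2` for some `α < λ`,
where `S = {α < λ : cf α < μ}`, such that `p⁻¹(1)` is non-stationary in every `β ≤ α` of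
cofinality `≥ μ`.  The function is encoded as `f : Ordinal → Option Bool` whose domain
(the set where `f` is `some _`) is exactly `S ∩ α`. -/
structure PCond (μ lam : Cardinal) where
  f : Ordinal → Option Bool
  dom_spec : ∃ α < lam.ord, ∀ γ : Ordinal, (f γ).isSome ↔ (γ < α ∧ γ.cof < μ)
  nonstat : ∀ β : Ordinal, μ ≤ β.cof →
    (∀ γ < β, γ.cof < μ → (f γ).isSome) →
    NonStationaryIn {γ : Ordinal | f γ = some true} β

namespace PCond

variable {μ lam : Cardinal}

/-- The order on `P(μ,λ)` is end-extension: `p ≤ q` iff `p ⊇ q` as functions. -/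
instance : PartialOrder (PCond μ lam) where
  le p q := ∀ γ : Ordinal, ∀ b : Bool, q.f γ = some b → p.f γ = some b
  le_refl p := fun _ _ h => h
  le_trans p q r hpq hqr := fun γ b h => hpq γ b (hqr γ b h)
  le_antisymm p q hpq hqp := by
    have hf : p.f = q.f := by
      funext γ
      cases hp : p.f γ with
      | some b => exact (hqp γ b hp).symm
      | none =>
        cases hq : q.f γ with
        | some b => exact absurd (hpq γ b hq) (by simp [hp])
        | none => rfl
    cases p; cases q; simp_all

theorem le_def (p q : PCond μ lam) :
    p ≤ q ↔ ∀ γ : Ordinal, ∀ b : Bool, q.f γ = some b → p.f γ = some b := Iff.rfl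

end PCond

universe u v

/-- A supremum of fewer than `cof a` ordinals below `a`, indexed by an initial segment, stays
below `a`. -/
theorem Ordinal.iSup_Iio_lt_of_card_lt_cof {η a : Ordinal.{u}} {g : Ordinal.{u} → Ordinal.{u}}
    (hη : η.card < a.cof) (hg : ∀ i < η, g i < a) : ⨆ i : Set.Iio η, g i < a := by
  refine Ordinal.lift_iSup_lt_of_lt_cof ?_ fun i => hg i i.2
  rw [Cardinal.mk_Iio_ordinal, ← Ordinal.lift_cof, Cardinal.lift_lift]
  exact Cardinal.lift_lt.2 hη

theorem Ordinal.lt_iSup_Iio_iff {η a : Ordinal.{u}} {g : Ordinal.{u} → Ordinal.{u}} :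
    a < ⨆ i : Set.Iio η, g i ↔ ∃ i < η, a < g i := by
  rw [Ordinal.lt_iSup_iff]
  simp

/-- Non-stationarity in `β` only depends on the part of the set below `β`. -/
theorem NonStationaryIn.mono {A B : Set Ordinal.{u}} {β : Ordinal.{u}} (h : NonStationaryIn A β)
    (hBA : ∀ x < β, x ∈ B → x ∈ A) : NonStationaryIn B β := by
  obtain ⟨c, hcβ, hunb, hcl, hdisj⟩ := h
  exact ⟨c, hcβ, hunb, hcl, Set.disjoint_left.2 fun x hxc hxB =>
    Set.disjoint_left.1 hdisj hxc (hBA x (hcβ x hxc) hxB)⟩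

namespace PCond

variable {μ lam : Cardinal.{u}}

open Classical in
/-- The union of the functions underlying a sequence of conditions. -/
noncomputable def unionFun (η : Ordinal.{u}) (p : Ordinal.{u} → PCond μ lam) (γ : Ordinal.{u}) :
    Option Bool :=
  if h : ∃ i < η, ((p i).f γ).isSome then (p h.choose).f γ else none

theorem isSome_unionFun {η : Ordinal.{u}} {p : Ordinal.{u} → PCond μ lam} {γ : Ordinal.{u}} :
    (unionFun η p γ).isSome ↔ ∃ i < η, ((p i).f γ).isSome := by
  unfold unionFun
  split_ifs with h
  · exact iff_of_true h.choose_spec.2 h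
  · exact iff_of_false (by simp) h

theorem unionFun_eq_of_isSome {η : Ordinal.{u}} {p : Ordinal.{u} → PCond μ lam}
    (hp : ∀ i j, i ≤ j → j < η → p j ≤ p i) {i γ : Ordinal.{u}} (hi : i < η)
    (h : ((p i).f γ).isSome) : unionFun η p γ = (p i).f γ := by
  have hex : ∃ i < η, ((p i).f γ).isSome := ⟨i, hi, h⟩
  rw [unionFun, dif_pos hex]
  obtain ⟨hj, hsome⟩ := hex.choose_spec
  obtain ⟨b, hb⟩ := Option.isSome_iff_exists.1 h
  obtain ⟨d, hd⟩ := Option.isSome_iff_exists.1 hsome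
  rcases le_total i hex.choose with hle | hle
  · rw [hb, hp _ _ hle hj γ b hb]
  · rw [hd, hp _ _ hle hi γ d hd]

end PCond

/-- If `λ` is regular uncountable and `μ < λ` is regular uncountable, then the forcing
`P(μ,λ)` is `μ`-closed. -/
theorem PCond_mu_closed (μ lam : Cardinal)
    (hlam : lam.IsRegular) (hlam' : Cardinal.aleph0 < lam)
    (hμ : μ.IsRegular) (hμ' : Cardinal.aleph0 < μ) (hμlam : μ < lam) :
    IsKappaClosed (PCond μ lam) μ := by
  intro η hη p hp
  have hcard : η.card < μ := Cardinal.lt_ord.1 hη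
  choose α hα hdom using fun i => (p i).dom_spec
  refine ⟨⟨PCond.unionFun η p, ⟨⨆ i : Set.Iio η, α i, ?_, fun γ => ?_⟩,
    fun β hβ hβdom => ?_⟩, fun i hi γ b hb => ?_⟩
  · refine Ordinal.iSup_Iio_lt_of_card_lt_cof ?_ fun i _ => hα i
    rw [hlam.cof_ord]
    exact hcard.trans hμlam
  · rw [PCond.isSome_unionFun, Ordinal.lt_iSup_Iio_iff]
    simp only [hdom]
    tauto
  · by_cases hcov : ∃ i < η, ∀ γ < β, γ.cof < μ → ((p i).f γ).isSome
    · obtain ⟨i, hi, hsome⟩ := hcov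
      refine ((p i).nonstat β hβ hsome).mono fun x hx hfx => ?_
      have hfx' : PCond.unionFun η p x = some true := hfx
      obtain ⟨j, -, hj⟩ := PCond.isSome_unionFun.1 (by rw [hfx']; rfl)
      rw [PCond.unionFun_eq_of_isSome hp hi (hsome x hx ((hdom j x).1 hj).2)] at hfx'
      exact hfx'
    · exfalso
      have hle : ∀ i < η, α i < β := by
        push Not at hcov
        intro i hi
        obtain ⟨γ, hγβ, hγ, hnone⟩ := hcov i hi
        refine lt_of_le_of_lt (not_lt.1 fun h => hnone ?_) hγβ
        exact (hdom i γ).2 ⟨h, hγ⟩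
      have hlim : Order.IsSuccLimit β :=
        Ordinal.one_lt_cof_iff.1 ((Cardinal.one_lt_aleph0.trans hμ').trans_le hβ)
      have hsup : ⨆ i : Set.Iio η, α i < β :=
        Ordinal.iSup_Iio_lt_of_card_lt_cof (hcard.trans_le hβ) hle
      have hsucc : (⨆ i : Set.Iio η, α i) + 1 < β := by
        rw [← Order.succ_eq_add_one]
        exact hlim.succ_lt hsup
      have hcof : ((⨆ i : Set.Iio η, α i) + 1).cof < μ := by
        rw [Ordinal.cof_add_one]
        exact Cardinal.one_lt_aleph0.trans hμ'
      obtain ⟨j, hj, hsome⟩ := PCond.isSome_unionFun.1 (hβdom _ hsucc hcof)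
      have := Ordinal.lt_iSup_Iio_iff.2 ⟨j, hj, ((hdom j _).1 hsome).1⟩
      exact (Order.lt_add_one_iff.2 le_rfl).not_gt this
  · exact (PCond.unionFun_eq_of_isSome hp hi (by rw [hb]; rfl)).trans hb
end

section
/- For every p ∈ P(μ,λ) there exists a ≤-decreasing sequence ⟨q_α : α < μ⟩ of elements of P(μ,λ) with q_α ≤ p for all α < μ which has no lower bound in P(μ,λ). In particular, P(μ,λ) is nowhere μ⁺-closed. -/
/-- An ordinal `a + i` with `0 < i < μ` has cofinality less than `μ`. -/
theorem Ordinal.cof_add_lt_of_lt_ord {μ : Cardinal} {a i : Ordinal}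
    (hi0 : i ≠ 0) (hi : i < μ.ord) : (a + i).cof < μ := by
  rw [Ordinal.cof_add _ hi0]
  exact (Ordinal.cof_le_card i).trans_lt (Cardinal.lt_ord.1 hi)

/-- Extending a condition of length `a` by ones up to length `a + i`, where `i < μ`. -/
theorem PCond.exists_extension_by_ones {μ lam : Cardinal}
    (hμ : Cardinal.aleph0 ≤ μ) (hμlam : μ < lam) (p : PCond μ lam) {a : Ordinal}
    (ha : a < lam.ord) (hp : ∀ γ : Ordinal, (p.f γ).isSome ↔ (γ < a ∧ γ.cof < μ))
    (i : Ordinal) (hi : i < μ.ord) :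
    ∃ q : PCond μ lam, ∀ γ : Ordinal, ∀ b : Bool, q.f γ = some b ↔
      (p.f γ = some b ∨ (a ≤ γ ∧ γ < a + i ∧ γ.cof < μ ∧ b = true)) := by
  classical
  have hlt : ∀ γ b, p.f γ = some b → γ < a ∧ γ.cof < μ := fun γ b h =>
    (hp γ).1 (by simp [h])
  let g : Ordinal → Option Bool := fun γ =>
    if γ < a then p.f γ else if γ < a + i ∧ γ.cof < μ then some true else none
  have hg : ∀ γ b, g γ = some b ↔
      (p.f γ = some b ∨ (a ≤ γ ∧ γ < a + i ∧ γ.cof < μ ∧ b = true)) := by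
    intro γ b
    by_cases h : γ < a
    · simp [g, h]
    · have h' : p.f γ ≠ some b := fun e => h (hlt γ b e).1
      simp only [g, if_neg h, h', false_or, not_lt.1 h, true_and]
      split_ifs with h2
      · simp [h2, eq_comm]
      · simp only [false_iff]
        exact fun h3 => h2 ⟨h3.1, h3.2.1⟩
  have hdom : ∀ γ, (g γ).isSome ↔ γ < a + i ∧ γ.cof < μ := by
    intro γ
    by_cases h : γ < a
    · have : γ < a + i := h.trans_le le_self_add
      simp [g, h, hp, this]
    · simp only [g, if_neg h]
      split_ifs with h2 <;> simp [h2]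
  refine ⟨⟨g, ⟨a + i, Ordinal.isPrincipal_add_ord (hμ.trans hμlam.le) ha
    (hi.trans (Cardinal.ord_lt_ord.2 hμlam)), hdom⟩, fun β hβ hsome => ?_⟩, hg⟩
  have hβa : β ≤ a := by
    by_contra! hlt'
    obtain ⟨j, rfl⟩ : ∃ j, β = a + j := ⟨β - a, (Ordinal.add_sub_cancel_of_le hlt'.le).symm⟩
    have hj0 : j ≠ 0 := by rintro rfl; simp at hlt'
    rcases lt_or_ge j μ.ord with hj | hj
    · exact absurd hβ (Ordinal.cof_add_lt_of_lt_ord hj0 hj).not_ge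
    · have hs : Order.succ i < μ.ord := (Cardinal.isSuccLimit_ord hμ).succ_lt hi
      have h := (hdom (a + Order.succ i)).1 (hsome _ (by gcongr; exact hs.trans_le hj)
        (Ordinal.cof_add_lt_of_lt_ord (Order.succ_ne_bot i) hs))
      exact absurd (lt_of_add_lt_add_left h.1) (Order.le_succ i).not_gt
  obtain ⟨c, hcβ, hunb, hcl, hdis⟩ := p.nonstat β hβ fun γ hγ hcof =>
    (hp γ).2 ⟨hγ.trans_le hβa, hcof⟩
  refine ⟨c, hcβ, hunb, hcl, Set.disjoint_left.2 fun x hx hx1 => ?_⟩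
  rcases (hg x true).1 hx1 with h | h
  · exact Set.disjoint_left.1 hdis hx h
  · exact ((hcβ x hx).trans_le hβa).not_ge h.1

/-- If `λ` is regular uncountable and `μ < λ` is regular uncountable, then below every
condition in `P(μ,λ)` there is a `≤`-decreasing sequence of length `μ` with no lower
bound; in particular `P(μ,λ)` is nowhere `μ⁺`-closed. -/
theorem PCond_nowhere_mu_succ_closed (μ lam : Cardinal)
    (hlam : lam.IsRegular) (hlam' : Cardinal.aleph0 < lam)
    (hμ : μ.IsRegular) (hμ' : Cardinal.aleph0 < μ) (hμlam : μ < lam)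
    (p : PCond μ lam) :
    ∃ q : Ordinal → PCond μ lam,
      (∀ α : Ordinal, α < μ.ord → q α ≤ p) ∧
      (∀ α β : Ordinal, α ≤ β → β < μ.ord → q β ≤ q α) ∧
      ¬ ∃ r : PCond μ lam, ∀ α : Ordinal, α < μ.ord → r ≤ q α := by
  classical
  obtain ⟨a, ha, hp⟩ := p.dom_spec
  choose q hq using p.exists_extension_by_ones hμ'.le hμlam ha hp
  refine ⟨fun i => if h : i < μ.ord then q i h else p, fun i hi => ?_, fun i j hij hj => ?_, ?_⟩
  · simp only [dif_pos hi]
    exact fun γ b h => (hq i hi γ b).2 (Or.inl h)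
  · have hi := hij.trans_lt hj
    simp only [dif_pos hi, dif_pos hj]
    intro γ b h
    rw [hq] at h ⊢
    exact h.imp_right fun h => ⟨h.1, h.2.1.trans_le (by gcongr), h.2.2⟩
  rintro ⟨r, hr⟩
  have hone : 1 < μ.ord := Ordinal.one_lt_omega0.trans (Cardinal.omega0_lt_ord.2 hμ')
  have hlim : Order.IsSuccLimit μ.ord := Cardinal.isSuccLimit_ord hμ'.le
  have hones : ∀ j < μ.ord, (a + j).cof < μ → r.f (a + j) = some true := by
    intro j hj hcof
    have hj' : Order.succ j < μ.ord := hlim.succ_lt hj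
    refine hr _ hj' (a + j) true ?_
    simp only [dif_pos hj']
    exact (hq _ hj' _ _).2 (Or.inr ⟨le_self_add, by gcongr; exact Order.lt_succ j, hcof, rfl⟩)
  have hcofβ : μ ≤ (a + μ.ord).cof := by
    rw [Ordinal.cof_add _ (zero_lt_one.trans hone).ne', hμ.cof_ord]
  obtain ⟨c, hcβ, hunb, -, hdis⟩ := r.nonstat (a + μ.ord) hcofβ fun γ hγ hcof => by
    rcases lt_or_ge γ a with h | h
    · obtain ⟨b, hb⟩ := Option.isSome_iff_exists.1 ((hp γ).2 ⟨h, hcof⟩)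
      have : r.f γ = some b := by
        refine hr 1 hone γ b ?_
        simp only [dif_pos hone]
        exact (hq _ hone _ _).2 (Or.inl hb)
      simp [this]
    · rw [← Ordinal.add_sub_cancel_of_le h] at hγ hcof ⊢
      simp [hones _ (lt_of_add_lt_add_left hγ) hcof]
  obtain ⟨x, hxc, hax, hxβ⟩ := hunb (a + 1) (by gcongr)
  obtain ⟨j, rfl⟩ : ∃ j, x = a + j :=
    ⟨x - a, (Ordinal.add_sub_cancel_of_le (le_self_add.trans hax)).symm⟩
  have hj : j < μ.ord := lt_of_add_lt_add_left hxβ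
  have hj0 : j ≠ 0 := by
    rintro rfl
    simp at hax
  exact Set.disjoint_left.1 hdis hxc (hones j hj (Ordinal.cof_add_lt_of_lt_ord hj0 hj))
end
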